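/- Let q ∈ (0,1), s ∈ (−1,0), k ∈ ℤ≥1, and let r ∈ (|s|, |s|^{−1}). Then for any λ, μ ∈ Sign⁺_k the spatial biorthogonality relation holds: c(λ)/((1−q)^k·k!) · (2πi)^{−k} ∮_{|u₁|=r} ⋯ ∮_{|u_k|=r} ∏_{1≤α≠β≤k} (u_α−u_β)/(u_α−qu_β) · F_λ(u₁,…,u_k) · F_μ(u₁^{−1},…,u_k^{−1}) · du₁⋯du_k/(u₁⋯u_k) = 1 if λ = μ and = 0 otherwise, where all k circles are positively oriented, centered at the origin, of the same radius r (the integrand, defined off the diagonals u_α = u_β, has removable singularities there, and changing it on this null set does not affect the iterated circle integrals). -/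

import Mathlib

open Finset

noncomputable section

/-- The finite q-Pochhammer symbol `(a;q)_m = ∏_{i=0}^{m-1} (1 - a q^i)`. -/
def qPoch {K : Type*} [CommRing K] (a q : K) (m : ℕ) : K :=
  ∏ i ∈ Finset.range m, (1 - a * q ^ i)

/-- Signatures of length `n`: weakly decreasing tuples of nonnegative integers. -/
abbrev Sign (n : ℕ) : Type :=
  {ν : Fin n → ℕ // ∀ i j : Fin n, i ≤ j → ν j ≤ ν i}

/-- The symmetric rational function `F_μ(u₁,…,u_M)` (symmetrization formula (4.20)). -/
def Ffun (q s : ℂ) {M : ℕ} (μ : Fin M → ℕ) (u : Fin M → ℂ) : ℂ :=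
  ((1 - q) ^ M / ∏ i, (1 - s * u i)) *
    ∑ σ : Equiv.Perm (Fin M),
      (∏ p ∈ (Finset.univ : Finset (Fin M × Fin M)).filter (fun p => p.1 < p.2),
        (u (σ p.1) - q * u (σ p.2)) / (u (σ p.1) - u (σ p.2))) *
      ∏ i, ((u (σ i) - s) / (1 - s * u (σ i))) ^ (μ i)

/-- Multiplicity of the value `k` among the parts of `lam`. -/
def mult {n : ℕ} (lam : Fin n → ℕ) (k : ℕ) : ℕ :=
  ((Finset.univ : Finset (Fin n)).filter (fun i => lam i = k)).card

/-- The conjugation constant `c(λ) = ∏_{k≥0} (s²;q)_{m_k}/(q;q)_{m_k}`. -/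
def cconst (q s : ℂ) {n : ℕ} (lam : Fin n → ℕ) : ℂ :=
  ∏ᶠ k : ℕ, qPoch (s ^ 2) q (mult lam k) / qPoch q q (mult lam k)

/-- `F^c_λ = c(λ)·F_λ`. -/
def Fc (q s : ℂ) {M : ℕ} (μ : Fin M → ℕ) (u : Fin M → ℂ) : ℂ :=
  cconst q s μ * Ffun q s μ u

/-- The symmetric rational function `G_ν(v₁,…,v_N)` (symmetrization formula (4.21)). -/
def Gfun (q s : ℂ) {n N : ℕ} (ν : Fin n → ℕ) (v : Fin N → ℂ) : ℂ :=
  if h : n - mult ν 0 ≤ N then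
    (qPoch (s ^ 2) q n / (qPoch q q (N - (n - mult ν 0)) * qPoch (s ^ 2) q (mult ν 0))) *
      ((1 - q) ^ N / ∏ j, (1 - s * v j)) *
      ∑ σ : Equiv.Perm (Fin N),
        (∏ p ∈ (Finset.univ : Finset (Fin N × Fin N)).filter (fun p => p.1 < p.2),
          (v (σ p.1) - q * v (σ p.2)) / (v (σ p.1) - v (σ p.2))) *
        (∏ j : Fin (n - mult ν 0),
          ((v (σ (Fin.castLE h j)) - s) / (1 - s * v (σ (Fin.castLE h j)))) ^
            (ν (Fin.castLE (Nat.sub_le n (mult ν 0)) j))) *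
        (∏ i : Fin (n - mult ν 0), v (σ (Fin.castLE h i)) / (v (σ (Fin.castLE h i)) - s)) *
        (∏ j ∈ (Finset.univ : Finset (Fin N)).filter (fun j : Fin N => n - mult ν 0 ≤ (j : ℕ)),
          (1 - s * q ^ (mult ν 0) * v (σ j)))
  else 0

/-- Iterated integral: `iterInt k ops f` applies the integration functional `ops i` to the
`i`-th variable (outermost first). -/
def iterInt : (k : ℕ) → (Fin k → ((ℂ → ℂ) → ℂ)) → ((Fin k → ℂ) → ℂ) → ℂ
  | 0, _, f => f Fin.elim0
  | k + 1, ops, f => ops 0 (fun z => iterInt k (fun i => ops i.succ) (fun u => f (Fin.cons z u)))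

open MeasureTheory Metric in
/-- The uniform probability measure on the circle of radius `r` centered at `0`. -/
def circleMeasure (r : ℝ) : Measure ℂ :=
  (ENNReal.ofReal (2 * Real.pi))⁻¹ •
    (volume.restrict (Set.Ioc 0 (2 * Real.pi))).map (circleMap 0 r)

instance circleMeasure.isProbabilityMeasure (r : ℝ) :
    MeasureTheory.IsProbabilityMeasure (circleMeasure r) := by
  constructor
  have hm : Measurable (circleMap 0 r) := (continuous_circleMap 0 r).measurable
  rw [circleMeasure, MeasureTheory.Measure.smul_apply,
    MeasureTheory.Measure.map_apply hm MeasurableSet.univ]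
  simp only [Set.preimage_univ, MeasureTheory.Measure.restrict_apply_univ, Real.volume_Ioc,
    sub_zero, smul_eq_mul]
  exact ENNReal.inv_mul_cancel (by simp [Real.pi_pos]) ENNReal.ofReal_ne_top

theorem circleMeasure_ae_mem_sphere {r : ℝ} (hr : 0 < r) :
    ∀ᵐ z ∂circleMeasure r, z ∈ Metric.sphere (0 : ℂ) r := by
  apply MeasureTheory.Measure.ae_smul_measure
  refine (MeasureTheory.ae_map_iff (continuous_circleMap 0 r).measurable.aemeasurable
    (p := fun z => z ∈ Metric.sphere (0 : ℂ) r) Metric.isClosed_sphere.measurableSet).2 ?_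
  exact Filter.Eventually.of_forall fun θ => circleMap_mem_sphere 0 hr.le θ

theorem integral_circleMeasure (r : ℝ) {g : ℂ → ℂ} (hg : MeasureTheory.StronglyMeasurable g) :
    ∫ z, g z ∂circleMeasure r = Real.circleAverage g 0 r := by
  rw [circleMeasure, MeasureTheory.integral_smul_measure,
    MeasureTheory.integral_map (continuous_circleMap 0 r).measurable.aemeasurable
      hg.aestronglyMeasurable, Real.circleAverage_def,
    intervalIntegral.integral_of_le Real.two_pi_pos.le, ENNReal.toReal_inv,
    ENNReal.toReal_ofReal Real.two_pi_pos.le]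

/-- The uniform probability measure on the torus `|u_i| = r`. -/
abbrev torusMeasure (k : ℕ) (r : ℝ) : MeasureTheory.Measure (Fin k → ℂ) :=
  MeasureTheory.Measure.pi fun _ => circleMeasure r

/-- The torus `|u_i| = r`. -/
abbrev torus (k : ℕ) (r : ℝ) : Set (Fin k → ℂ) :=
  Set.univ.pi fun _ => Metric.sphere 0 r

theorem torusMeasure_ae_mem_torus (k : ℕ) {r : ℝ} (hr : 0 < r) :
    ∀ᵐ u ∂torusMeasure k r, u ∈ torus k r := by
  have h : ∀ᵐ u ∂torusMeasure k r, ∀ i, u i ∈ Metric.sphere (0 : ℂ) r := by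
    rw [MeasureTheory.ae_all_iff]
    intro i
    exact (MeasureTheory.Measure.quasiMeasurePreserving_eval
      (fun _ => circleMeasure r) i).ae (circleMeasure_ae_mem_sphere hr)
  filter_upwards [h] with u hu i _ using hu i

theorem integrable_torusMeasure {k : ℕ} {r : ℝ} (hr : 0 < r) {f : (Fin k → ℂ) → ℂ}
    (hf : ContinuousOn f (torus k r)) : MeasureTheory.Integrable f (torusMeasure k r) := by
  have hK : IsCompact (torus k r) := isCompact_univ_pi fun _ => isCompact_sphere 0 r
  have h := hf.integrableOn_compact (μ := torusMeasure k r) hK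
  rwa [MeasureTheory.IntegrableOn,
    MeasureTheory.Measure.restrict_eq_self_of_ae_mem (torusMeasure_ae_mem_torus k hr)] at h

theorem integral_torusMeasure_insertNth {k : ℕ} {r : ℝ} (j : Fin (k + 1))
    {f : (Fin (k + 1) → ℂ) → ℂ} (hf : MeasureTheory.Integrable f (torusMeasure (k + 1) r)) :
    ∫ u, f u ∂torusMeasure (k + 1) r =
        ∫ z, ∫ y, f (j.insertNth z y) ∂torusMeasure k r ∂circleMeasure r ∧
      ∫ u, f u ∂torusMeasure (k + 1) r =
        ∫ y, ∫ z, f (j.insertNth z y) ∂circleMeasure r ∂torusMeasure k r := by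
  have hp := (MeasureTheory.measurePreserving_piFinSuccAbove
    (fun _ : Fin (k + 1) => circleMeasure r) j).symm
  have he : ∫ u, f u ∂torusMeasure (k + 1) r =
      ∫ p : ℂ × (Fin k → ℂ), f (j.insertNth p.1 p.2)
        ∂(circleMeasure r).prod (torusMeasure k r) :=
    (hp.integral_comp' f).symm
  have hi : MeasureTheory.Integrable (fun p : ℂ × (Fin k → ℂ) => f (j.insertNth p.1 p.2))
      ((circleMeasure r).prod (torusMeasure k r)) :=
    hp.integrable_comp_of_integrable hf
  exact ⟨he.trans (MeasureTheory.integral_prod _ hi),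
    he.trans (MeasureTheory.integral_prod_symm _ hi)⟩

theorem integral_torusMeasure_perm {k : ℕ} {r : ℝ} (σ : Equiv.Perm (Fin k))
    (f : (Fin k → ℂ) → ℂ) :
    ∫ u, f (u ∘ σ) ∂torusMeasure k r = ∫ u, f u ∂torusMeasure k r := by
  have hp := MeasureTheory.measurePreserving_piCongrLeft
    (fun _ : Fin k => circleMeasure r) σ.symm
  rw [← hp.integral_comp' f]
  congr 1
  ext u
  congr 1
  ext i
  simp [MeasurableEquiv.coe_piCongrLeft, Equiv.piCongrLeft_apply]

theorem iterInt_const_mul (k : ℕ) (op : (ℂ → ℂ) → ℂ)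
    (h : ∀ c g, op (fun z => c * g z) = c * op g) (c : ℂ) (f : (Fin k → ℂ) → ℂ) :
    iterInt k (fun _ => op) (fun u => c * f u) = c * iterInt k (fun _ => op) f := by
  induction k with
  | zero => rfl
  | succ k ih =>
    simp only [iterInt]
    rw [← h]
    congr 1
    ext z
    exact ih _

theorem iterInt_circleIntegral (k : ℕ) {r : ℝ} (hr : r ≠ 0) (f : (Fin k → ℂ) → ℂ) :
    (1 / (2 * (Real.pi : ℂ) * Complex.I)) ^ k *
        iterInt k (fun _ => fun g => ∮ z in C(0, r), g z) (fun u => f u * ∏ i, (u i)⁻¹) =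
      iterInt k (fun _ => fun g => Real.circleAverage g 0 r) f := by
  induction k with
  | zero => simp [iterInt]
  | succ k ih =>
    simp only [iterInt]
    rw [Real.circleAverage_eq_circleIntegral hr, pow_succ', mul_assoc]
    simp only [one_div, smul_eq_mul, sub_zero]
    congr 1
    rw [← circleIntegral.integral_const_mul]
    congr 1
    ext z
    rw [← ih, one_div, mul_left_comm, ← iterInt_const_mul k _
      (fun c g => circleIntegral.integral_const_mul c g 0 r) z⁻¹]
    refine congrArg _ (congrArg _ (funext fun u => ?_))
    rw [Fin.prod_univ_succ]
    simp only [Fin.cons_zero, Fin.cons_succ]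
    ring

theorem iterInt_circleAverage_congr {k : ℕ} {r : ℝ} (hr : 0 < r) (A : Set ℂ) (hA : A.Finite)
    {f g : (Fin k → ℂ) → ℂ}
    (h : ∀ u ∈ torus k r, Function.Injective u → (∀ i, u i ∉ A) → f u = g u) :
    iterInt k (fun _ => fun g => Real.circleAverage g 0 r) f =
      iterInt k (fun _ => fun g => Real.circleAverage g 0 r) g := by
  induction k generalizing A with
  | zero =>
    exact h _ (fun i => i.elim0) (fun i => i.elim0) fun i => i.elim0
  | succ k ih =>
    simp only [iterInt]
    apply Real.circleAverage_congr_codiscreteWithin _ hr.ne'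
    rw [abs_of_pos hr]
    filter_upwards [Filter.self_mem_codiscreteWithin (Metric.sphere (0 : ℂ) r),
      compl_finite_mem_codiscreteWithin hA] with z hz hzA
    refine ih (insert z A) (hA.insert z) fun u hu hinj huA => h _ ?_ ?_ ?_
    · intro i _
      refine Fin.cases ?_ (fun i => ?_) i
      · simpa using hz
      · simpa using hu i (Set.mem_univ _)
    · rw [Fin.cons_injective_iff]
      refine ⟨?_, hinj⟩
      rintro ⟨i, hi⟩
      exact huA i (Or.inl hi)
    · intro i
      refine Fin.cases ?_ (fun i => ?_) i
      · simpa using hzA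
      · simpa using fun hi => huA i (Or.inr hi)

theorem circleAverage_inv (r : ℝ) (f : ℂ → ℂ) :
    Real.circleAverage (fun z => f z⁻¹) 0 r = Real.circleAverage f 0 r⁻¹ := by
  rw [Real.circleAverage_eq_circleAverage_zero_one, ← Real.circleAverage_zero_one_congr_inv,
    Real.circleAverage_eq_circleAverage_zero_one (R := r⁻¹)]
  simp [mul_comm]

theorem iterInt_circleAverage_inv (k : ℕ) (r : ℝ) (f : (Fin k → ℂ) → ℂ) :
    iterInt k (fun _ => fun g => Real.circleAverage g 0 r) (fun u => f fun i => (u i)⁻¹) =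
      iterInt k (fun _ => fun g => Real.circleAverage g 0 r⁻¹) f := by
  induction k with
  | zero =>
    simp only [iterInt]
    congr 1
    ext i
    exact i.elim0
  | succ k ih =>
    simp only [iterInt]
    rw [← circleAverage_inv]
    congr 1
    ext z
    rw [← ih]
    congr 1
    ext u
    congr 1
    ext i
    refine Fin.cases ?_ (fun i => ?_) i <;> simp

theorem iterInt_circleAverage_eq_integral {k : ℕ} {r : ℝ} (hr : 0 < r) {f : (Fin k → ℂ) → ℂ}
    (hm : Measurable f) (hf : ContinuousOn f (torus k r)) :
    iterInt k (fun _ => fun g => Real.circleAverage g 0 r) f = ∫ u, f u ∂torusMeasure k r := by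
  induction k with
  | zero =>
    simp only [iterInt]
    rw [torusMeasure, MeasureTheory.Measure.pi_of_empty _ Fin.elim0, MeasureTheory.integral_dirac]
  | succ k ih =>
    rw [(integral_torusMeasure_insertNth 0 (integrable_torusMeasure hr hf)).1,
      integral_circleMeasure]
    · simp only [iterInt]
      apply Real.circleAverage_congr_sphere
      intro z hz
      rw [abs_of_pos hr] at hz
      have hc : Continuous fun y : Fin k → ℂ => (Fin.cons z y : Fin (k + 1) → ℂ) := by
        fun_prop
      simp only [Fin.insertNth_zero]
      refine ih (hm.comp hc.measurable) (hf.comp hc.continuousOn fun y hy i _ => ?_)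
      refine Fin.cases ?_ (fun i => ?_) i
      · simpa using hz
      · simpa using hy i (Set.mem_univ _)
    · have h : Measurable fun p : ℂ × (Fin k → ℂ) =>
          f ((0 : Fin (k + 1)).insertNth p.1 p.2) :=
        hm.comp (MeasurableEquiv.piFinSuccAbove (fun _ => ℂ) 0).symm.measurable
      exact h.stronglyMeasurable.integral_prod_right

open Polynomial in
theorem sum_prod_sub_mul_div_sub {K ι : Type*} [Field K] [DecidableEq ι] (S : Finset ι)
    (u : ι → K) {q : K} (hq : q ≠ 1) (hu : Set.InjOn u S) (h0 : ∀ i ∈ S, u i ≠ 0) :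
    ∑ p ∈ S, ∏ x ∈ S.erase p, (u x - q * u p) / (u x - u p) = ∑ t ∈ range #S, q ^ t := by
  set P : K[X] := (∏ j ∈ S, (C (u j) - C q * X)) - C (q ^ #S) * ∏ j ∈ S, (C (u j) - X) with hP
  have hdeg (c : K) : ∀ j ∈ S, (C (u j) - C c * X).natDegree ≤ 1 := fun j _ => by
    compute_degree
  have hprod (c : K) : (∏ j ∈ S, (C (u j) - C c * X)).natDegree ≤ #S := by
    refine (natDegree_prod_le _ _).trans ((sum_le_sum (hdeg c)).trans ?_)
    simp
  have hcoeff (c : K) : (∏ j ∈ S, (C (u j) - C c * X)).coeff #S = (-c) ^ #S := by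
    have h := coeff_prod_of_natDegree_le (s := S) (fun j => C (u j) - C c * X) 1 (hdeg c)
    rw [mul_one] at h
    rw [h, ← prod_const]
    refine prod_congr rfl fun j _ => ?_
    simp
  have hlt : P.degree < #S := by
    rw [degree_lt_iff_coeff_zero]
    intro m hm
    have h1 := hcoeff 1
    have h2 := hprod 1
    simp only [C_1, one_mul] at h1 h2
    rw [hP, coeff_sub, coeff_C_mul]
    rcases hm.eq_or_lt with rfl | hm
    · rw [hcoeff q, h1, ← mul_pow, mul_neg_one, sub_self]
    · rw [coeff_eq_zero_of_natDegree_lt ((hprod q).trans_lt hm),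
        coeff_eq_zero_of_natDegree_lt (h2.trans_lt hm), mul_zero, sub_zero]
  have heval (z : K) : P.eval z =
      (∏ j ∈ S, (u j - q * z)) - q ^ #S * ∏ j ∈ S, (u j - z) := by
    simp [hP, eval_prod]
  have h := congrArg (eval 0) (Lagrange.eq_interpolate hu hlt)
  rw [heval, Lagrange.interpolate_apply, eval_finsetSum] at h
  simp only [mul_zero, sub_zero] at h
  have hU : ∏ j ∈ S, u j ≠ 0 := prod_ne_zero_iff.2 h0
  have hterm : ∀ p ∈ S, eval 0 (C (eval (u p) P) * Lagrange.basis S u p) =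
      (∏ j ∈ S, u j) * ((1 - q) * ∏ x ∈ S.erase p, (u x - q * u p) / (u x - u p)) := by
    intro p hp
    have hz : ∏ j ∈ S, (u j - u p) = 0 := prod_eq_zero hp (sub_self _)
    rw [eval_mul, eval_C, heval, hz, mul_zero, sub_zero, Lagrange.basis, eval_prod,
      ← mul_prod_erase _ _ hp, ← mul_prod_erase S u hp]
    have hb : ∏ j ∈ S.erase p, eval 0 (Lagrange.basisDivisor (u p) (u j)) =
        ∏ j ∈ S.erase p, u j / (u j - u p) := by
      refine prod_congr rfl fun j hj => ?_
      have hne : u p - u j ≠ 0 := sub_ne_zero.2 fun e =>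
        (ne_of_mem_erase hj) (hu (mem_of_mem_erase hj) hp e.symm)
      have hne' : u j - u p ≠ 0 := sub_ne_zero.2 (sub_ne_zero.1 hne).symm
      simp only [Lagrange.basisDivisor, eval_mul, eval_C, eval_sub, eval_X]
      field_simp
      ring
    rw [hb, prod_div_distrib, prod_div_distrib]
    ring
  rw [sum_congr rfl hterm, ← mul_sum, ← mul_sum] at h
  have h1 : (1 : K) - q ≠ 0 := sub_ne_zero.2 hq.symm
  have h2 : (∏ j ∈ S, u j) * (1 - q ^ #S) = (∏ j ∈ S, u j) *
      ((1 - q) * ∑ p ∈ S, ∏ x ∈ S.erase p, (u x - q * u p) / (u x - u p)) := by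
    rw [← h]; ring
  have h3 := mul_left_cancel₀ hU h2
  rw [← mul_neg_geom_sum] at h3
  exact (mul_left_cancel₀ h1 h3).symm

theorem prod_lt_comp_perm {ι M : Type*} [Fintype ι] [LinearOrder ι] [CommMonoid M]
    (ρ : Equiv.Perm ι) (G : ι → ι → M) :
    ∏ p ∈ (univ : Finset (ι × ι)).filter (fun p => p.1 < p.2), G (ρ p.1) (ρ p.2) =
      ∏ p ∈ (univ : Finset (ι × ι)).filter (fun p => p.1 < p.2),
        if ρ.symm p.1 < ρ.symm p.2 then G p.1 p.2 else G p.2 p.1 := by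
  have h1 : ∏ p ∈ (univ : Finset (ι × ι)).filter (fun p => p.1 < p.2), G (ρ p.1) (ρ p.2) =
      ∏ p : ι × ι, if ρ.symm p.1 < ρ.symm p.2 then G p.1 p.2 else 1 := by
    rw [prod_filter]
    refine Fintype.prod_equiv (Equiv.prodCongr ρ ρ) _ _ fun p => ?_
    simp
  have h2 : ∏ p : ι × ι, (if ρ.symm p.1 < ρ.symm p.2 then G p.1 p.2 else 1) =
      (∏ p : ι × ι, if p.1 < p.2 then
        (if ρ.symm p.1 < ρ.symm p.2 then G p.1 p.2 else 1) else 1) *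
      ∏ p : ι × ι, if p.2 < p.1 then
        (if ρ.symm p.1 < ρ.symm p.2 then G p.1 p.2 else 1) else 1 := by
    rw [← prod_mul_distrib]
    refine prod_congr rfl fun p _ => ?_
    rcases lt_trichotomy p.1 p.2 with h | h | h
    · simp [h, h.not_gt]
    · simp [h]
    · simp [h, h.not_gt]
  have h3 : (∏ p : ι × ι, if p.2 < p.1 then
        (if ρ.symm p.1 < ρ.symm p.2 then G p.1 p.2 else 1) else 1) =
      ∏ p : ι × ι, if p.1 < p.2 then
        (if ρ.symm p.2 < ρ.symm p.1 then G p.2 p.1 else 1) else 1 :=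
    Fintype.prod_equiv (Equiv.prodComm ι ι) _ _ fun p => rfl
  rw [h1, h2, h3, ← prod_mul_distrib, prod_filter]
  refine prod_congr rfl fun p _ => ?_
  rcases lt_trichotomy (ρ.symm p.1) (ρ.symm p.2) with h | h | h
  · simp [h, h.not_gt]
  · simp [ρ.symm.injective h]
  · simp [h, h.not_gt]

theorem prod_pairs_succ {k : ℕ} {M : Type*} [CommMonoid M] (G : Fin (k + 1) → Fin (k + 1) → M) :
    ∏ p ∈ (univ : Finset (Fin (k + 1) × Fin (k + 1))).filter (fun p => p.1 < p.2), G p.1 p.2 =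
      (∏ j : Fin k, G 0 j.succ) *
        ∏ p ∈ (univ : Finset (Fin k × Fin k)).filter (fun p => p.1 < p.2),
          G p.1.succ p.2.succ := by
  simp only [prod_filter, Fintype.prod_prod_type, Fin.prod_univ_succ, if_false,
    Fin.succ_pos, if_true, Fin.not_lt_zero, one_mul, Fin.succ_lt_succ_iff]

/-- The Hall–Littlewood identity, summed over the stabilizer of a sequence `lam`. -/
theorem sum_stabilizer_prod_sub_mul_div_sub {K ι : Type*} [Field K] [DecidableEq ι] {k : ℕ}
    (lam : Fin k → ι) (u : Fin k → K) {q : K} (hq : q ≠ 1) (hu : Function.Injective u)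
    (h0 : ∀ i, u i ≠ 0) :
    ∑ ρ : Equiv.Perm (Fin k), (if lam ∘ ρ = lam then
        ∏ p ∈ (univ : Finset (Fin k × Fin k)).filter (fun p => p.1 < p.2),
          (if lam p.1 = lam p.2 then
            (u (ρ p.2) - q * u (ρ p.1)) / (u (ρ p.2) - u (ρ p.1)) else 1) else 0) =
      ∏ i, ∑ t ∈ range (#{j | i < j ∧ lam j = lam i} + 1), q ^ t := by
  induction k with
  | zero => simp [Subsingleton.elim _ lam]
  | succ k ih =>
    rw [← Equiv.Perm.decomposeFin.symm.sum_comp, Fintype.sum_prod_type, Fin.prod_univ_succ]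
    have hterm (p : Fin (k + 1)) : ∑ e : Equiv.Perm (Fin k),
        (if lam ∘ Equiv.Perm.decomposeFin.symm (p, e) = lam then
          ∏ x ∈ (univ : Finset (Fin (k + 1) × Fin (k + 1))).filter (fun x => x.1 < x.2),
          (if lam x.1 = lam x.2 then
            (u (Equiv.Perm.decomposeFin.symm (p, e) x.2) -
                q * u (Equiv.Perm.decomposeFin.symm (p, e) x.1)) /
              (u (Equiv.Perm.decomposeFin.symm (p, e) x.2) -
                u (Equiv.Perm.decomposeFin.symm (p, e) x.1)) else 1) else 0) =
        (if lam p = lam 0 then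
          ∏ x ∈ ({x | lam x = lam 0} : Finset (Fin (k + 1))).erase p,
            (u x - q * u p) / (u x - u p) else 0) *
        ∏ i : Fin k, ∑ t ∈ range (#{j : Fin k | i < j ∧ lam j.succ = lam i.succ} + 1), q ^ t := by
      by_cases hp : lam p = lam 0
      · have hsw : ∀ x, lam (Equiv.swap 0 p x) = lam x := by
          intro x
          rcases eq_or_ne x 0 with rfl | h1
          · simp [hp]
          rcases eq_or_ne x p with rfl | h2
          · simp [hp]
          rw [Equiv.swap_apply_of_ne_of_ne h1 h2]
        have hcond (e : Equiv.Perm (Fin k)) : lam ∘ Equiv.Perm.decomposeFin.symm (p, e) = lam ↔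
            (fun i : Fin k => lam i.succ) ∘ e = fun i : Fin k => lam i.succ := by
          simp only [funext_iff, Fin.forall_fin_succ, Function.comp_apply,
            Equiv.Perm.decomposeFin_symm_apply_zero, Equiv.Perm.decomposeFin_symm_apply_succ,
            hsw, hp, true_and]
        have ih' := ih (fun i : Fin k => lam i.succ)
          (fun i => u (Equiv.swap 0 p i.succ))
          (hu.comp ((Equiv.swap 0 p).injective.comp (Fin.succ_injective k))) (fun i => h0 _)
        rw [if_pos hp, ← ih', mul_sum]
        refine sum_congr rfl fun e _ => ?_
        simp only [hcond]
        split_ifs with he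
        · rw [prod_pairs_succ fun x y => if lam x = lam y then
            (u (Equiv.Perm.decomposeFin.symm (p, e) y) -
                q * u (Equiv.Perm.decomposeFin.symm (p, e) x)) /
              (u (Equiv.Perm.decomposeFin.symm (p, e) y) -
                u (Equiv.Perm.decomposeFin.symm (p, e) x)) else 1]
          simp only [Equiv.Perm.decomposeFin_symm_apply_zero,
            Equiv.Perm.decomposeFin_symm_apply_succ]
          congr 1
          have hl : ∀ j : Fin k, lam j.succ = lam (Equiv.swap 0 p (e j).succ) := fun j => by
            rw [hsw]
            exact (congrFun he j).symm
          have hF : ∀ F : Fin (k + 1) → K, ∏ j : Fin k, F (Equiv.swap 0 p (e j).succ) =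
              ∏ x ∈ univ.erase p, F x := by
            intro F
            refine prod_nbij (fun j => Equiv.swap 0 p (e j).succ) ?_ ?_ ?_ fun _ _ => rfl
            · intro j _
              rw [mem_erase, Ne, Equiv.swap_apply_eq_iff, Equiv.swap_apply_right]
              exact ⟨Fin.succ_ne_zero _, mem_univ _⟩
            · exact ((Equiv.swap 0 p).injective.comp
                ((Fin.succ_injective k).comp e.injective)).injOn
            · intro x hx
              have hx0 : Equiv.swap 0 p x ≠ 0 := by
                rw [Ne, Equiv.swap_apply_eq_iff, Equiv.swap_apply_left]
                simpa using hx
              obtain ⟨j, hj⟩ := Fin.exists_succ_eq.2 hx0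
              exact ⟨e.symm j, by simp, by simp [hj]⟩
          calc ∏ j : Fin k, (if lam 0 = lam j.succ then
                (u (Equiv.swap 0 p (e j).succ) - q * u p) /
                  (u (Equiv.swap 0 p (e j).succ) - u p) else 1)
              = ∏ j : Fin k, (fun x => if lam x = lam 0 then
                (u x - q * u p) / (u x - u p) else 1) (Equiv.swap 0 p (e j).succ) := by
                refine prod_congr rfl fun j _ => ?_
                simp only [← hl j, eq_comm (a := lam 0)]
            _ = _ := by
                rw [hF fun x => if lam x = lam 0 then
                  (u x - q * u p) / (u x - u p) else 1, ← prod_filter, filter_erase]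
        · rw [mul_zero]
      · rw [if_neg hp, zero_mul]
        refine sum_eq_zero fun e _ => if_neg fun h => hp ?_
        simpa using congrFun h 0
    rw [sum_congr rfl fun p _ => hterm p, ← sum_mul, ← sum_filter,
      sum_prod_sub_mul_div_sub _ u hq hu.injOn fun i _ => h0 i]
    congr 1
    · rw [Fin.card_filter_univ_succ, Fin.card_filter_univ_succ]
      simp
    · refine prod_congr rfl fun i _ => ?_
      rw [Fin.card_filter_univ_succ]
      simp

theorem prod_card_filter_lt {ι M : Type*} [LinearOrder ι] [CommMonoid M] (S : Finset ι)
    (f : ℕ → M) : ∏ i ∈ S, f #{j ∈ S | j < i} = ∏ t ∈ range #S, f t := by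
  induction S using Finset.induction_on_max with
  | empty => simp
  | insert a S ha ih =>
    have hn : a ∉ S := fun h => (ha a h).false
    rw [prod_insert hn, card_insert_of_notMem hn, prod_range_succ, mul_comm, ← ih]
    congr 1
    · refine prod_congr rfl fun i hi => ?_
      rw [filter_insert, if_neg (ha i hi).not_gt]
    · rw [filter_insert, if_neg (lt_irrefl a), filter_true_of_mem ha]

theorem prod_card_filter_gt {ι M : Type*} [LinearOrder ι] [CommMonoid M] (S : Finset ι)
    (f : ℕ → M) : ∏ i ∈ S, f #{j ∈ S | i < j} = ∏ t ∈ range #S, f t :=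
  prod_card_filter_lt (ι := ιᵒᵈ) S f

theorem prod_card_eq_finprod_mult {k : ℕ} {M : Type*} [CommMonoid M] (lam : Fin k → ℕ)
    (R : Fin k → Fin k → Prop) [∀ i j, Decidable (R i j)] (f : ℕ → M)
    (hR : ∀ S : Finset (Fin k), ∏ i ∈ S, f #{j ∈ S | R i j} = ∏ t ∈ range #S, f t) :
    ∏ i, f #{j | R i j ∧ lam j = lam i} = ∏ᶠ v : ℕ, ∏ t ∈ range (mult lam v), f t := by
  rw [finprod_eq_prod_of_mulSupport_subset (s := univ.image lam)]
  · rw [← prod_fiberwise_of_maps_to (g := lam) (t := univ.image lam)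
      fun i _ => mem_image_of_mem _ (mem_univ i)]
    refine prod_congr rfl fun v _ => ?_
    rw [mult, ← hR]
    refine prod_congr rfl fun i hi => ?_
    rw [filter_filter]
    congr 2
    ext j
    simp [(mem_filter.1 hi).2, and_comm]
  · intro v hv
    by_contra h
    apply hv
    have : mult lam v = 0 := by
      rw [mult, card_eq_zero, filter_eq_empty_iff]
      intro i _ hi
      exact h (by simpa using ⟨i, hi⟩)
    simp [this]

theorem exists_ge_of_forall_le_max {k : ℕ} {lam mu : Fin k → ℕ} (hl : Antitone lam)
    (hm : Antitone mu) (π : Equiv.Perm (Fin k))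
    (h : ∀ j, (∀ i < j, π i < π j) → lam j ≤ mu (π j)) (i : Fin k) :
    lam i ≤ mu i ∧ lam i ≤ mu (π i) := by
  obtain ⟨j, hj, hmax⟩ := (Iic i).exists_max_image π ⟨i, mem_Iic.2 le_rfl⟩
  rw [mem_Iic] at hj
  have hle : lam i ≤ mu (π j) := (hl hj).trans <| h j fun a ha =>
    (hmax a (mem_Iic.2 (ha.le.trans hj))).lt_of_ne fun e => ha.ne (π.injective e)
  have hij : i ≤ π j := by
    have hc := card_le_card_of_injOn (s := Iic i) (t := Iic (π j)) π
      (fun a ha => by simpa using hmax a ha) π.injective.injOn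
    rw [Fin.card_Iic, Fin.card_Iic] at hc
    exact Fin.le_def.2 (by omega)
  exact ⟨hle.trans (hm hij), hle.trans (hm (hmax i (mem_Iic.2 le_rfl)))⟩

theorem comp_perm_eq_of_le {ι : Type*} [Fintype ι] {lam : ι → ℕ} (π : Equiv.Perm ι)
    (h : ∀ i, lam i ≤ lam (π i)) : lam ∘ π = lam := by
  have := (sum_eq_sum_iff_of_le fun i _ => h i).1 (Equiv.sum_comp π lam).symm
  ext i
  exact (this i (mem_univ i)).symm

theorem mem_torus_iff {k : ℕ} {r : ℝ} {u : Fin k → ℂ} : u ∈ torus k r ↔ ∀ i, ‖u i‖ = r := by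
  simp [torus]

theorem comp_perm_mem_torus {k : ℕ} {r : ℝ} {u : Fin k → ℂ} (hu : u ∈ torus k r)
    (σ : Equiv.Perm (Fin k)) : u ∘ σ ∈ torus k r :=
  mem_torus_iff.2 fun i => mem_torus_iff.1 hu (σ i)

theorem integral_torusMeasure_eq_of_circleAverage {k : ℕ} {r : ℝ} (hr : 0 < r) (j : Fin (k + 1))
    {f : (Fin (k + 1) → ℂ) → ℂ} {g : (Fin k → ℂ) → ℂ} (hm : Measurable f)
    (hf : ContinuousOn f (torus (k + 1) r))
    (h : ∀ y ∈ torus k r, Real.circleAverage (fun z => f (j.insertNth z y)) 0 r = g y) :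
    ∫ u, f u ∂torusMeasure (k + 1) r = ∫ y, g y ∂torusMeasure k r := by
  rw [(integral_torusMeasure_insertNth j (integrable_torusMeasure hr hf)).2]
  refine MeasureTheory.integral_congr_ae ?_
  filter_upwards [torusMeasure_ae_mem_torus k hr] with y hy
  rw [← h y hy, integral_circleMeasure]
  refine Measurable.stronglyMeasurable (hm.comp ?_)
  exact (MeasurableEquiv.piFinSuccAbove (fun _ => ℂ) j).symm.measurable.comp
    measurable_prodMk_right

theorem sub_mul_ne_zero_of_norm {q x y : ℂ} {r : ℝ} (hq : ‖q‖ < 1) (hr : 0 < r) (hx : ‖x‖ ≤ r)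
    (hy : ‖y‖ = r) : y - q * x ≠ 0 := by
  intro h
  have h1 : ‖y‖ = ‖q‖ * ‖x‖ := by rw [sub_eq_zero.1 h, norm_mul]
  nlinarith [norm_nonneg q, norm_nonneg x]

theorem one_sub_mul_ne_zero_of_norm {s x : ℂ} {r : ℝ} (hs : ‖s‖ * r < 1) (hx : ‖x‖ ≤ r) :
    1 - s * x ≠ 0 := by
  intro h
  have h1 : ‖(1 : ℂ)‖ = ‖s‖ * ‖x‖ := by rw [sub_eq_zero.1 h, norm_mul]
  rw [norm_one] at h1
  nlinarith [norm_nonneg s]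

theorem sub_ne_zero_of_norm {a x : ℂ} {r : ℝ} (ha : ‖a‖ < r) (hx : ‖x‖ = r) : x - a ≠ 0 := by
  intro h
  rw [sub_eq_zero.1 h] at hx
  exact ha.ne hx

/-- The contribution of a permutation to the spatial pairing of `lam` and `mu`, after cancelling
the factors `u_α - u_β`. -/
def scatterTerm (q s : ℂ) {k : ℕ} (lam mu : Fin k → ℕ) (ρ : Equiv.Perm (Fin k))
    (u : Fin k → ℂ) : ℂ :=
  (∏ p ∈ (univ : Finset (Fin k × Fin k)).filter (fun p => p.1 < p.2),
    if ρ.symm p.1 < ρ.symm p.2 then 1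
    else -((u p.1 - q * u p.2) / (u p.2 - q * u p.1))) *
  ∏ i, ((u i - s) / (1 - s * u i)) ^ lam i * ((1 - s * u i) / (u i - s)) ^ mu (ρ.symm i) *
    (u i / ((1 - s * u i) * (u i - s)))

theorem measurable_scatterTerm (q s : ℂ) {k : ℕ} (lam mu : Fin k → ℕ) (ρ : Equiv.Perm (Fin k)) :
    Measurable (scatterTerm q s lam mu ρ) := by
  refine Measurable.mul (Finset.measurable_prod _ fun p _ => ?_)
    (Finset.measurable_prod _ fun i _ => by fun_prop)
  split_ifs <;> fun_prop

theorem continuousOn_scatterTerm {q s : ℂ} {r : ℝ} (hq : ‖q‖ < 1) (hs : ‖s‖ < r)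
    (hs' : ‖s‖ * r < 1) {k : ℕ} (lam mu : Fin k → ℕ) (ρ : Equiv.Perm (Fin k)) :
    ContinuousOn (scatterTerm q s lam mu ρ) (torus k r) := by
  have hr : 0 < r := (norm_nonneg s).trans_lt hs
  have h1 : ∀ u ∈ torus k r, ∀ i, 1 - s * u i ≠ 0 := fun u hu i =>
    one_sub_mul_ne_zero_of_norm hs' (mem_torus_iff.1 hu i).le
  have h2 : ∀ u ∈ torus k r, ∀ i, u i - s ≠ 0 := fun u hu i =>
    sub_ne_zero_of_norm hs (mem_torus_iff.1 hu i)
  have h3 : ∀ u ∈ torus k r, ∀ i j, u j - q * u i ≠ 0 := fun u hu i j =>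
    sub_mul_ne_zero_of_norm hq hr (mem_torus_iff.1 hu i).le (mem_torus_iff.1 hu j)
  refine ContinuousOn.mul (continuousOn_finsetProd _ fun p _ => ?_)
    (continuousOn_finsetProd _ fun i _ => ?_)
  · split_ifs
    · exact continuousOn_const
    · exact (ContinuousOn.div (by fun_prop) (by fun_prop) fun u hu => h3 u hu _ _).neg
  · refine ContinuousOn.mul (ContinuousOn.mul ?_ ?_) ?_
    · exact (ContinuousOn.div (by fun_prop) (by fun_prop) fun u hu => h1 u hu i).pow _
    · exact (ContinuousOn.div (by fun_prop) (by fun_prop) fun u hu => h2 u hu i).pow _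
    · exact ContinuousOn.div (by fun_prop) (by fun_prop)
        fun u hu => mul_ne_zero (h1 u hu i) (h2 u hu i)

theorem prod_offDiag_eq_prod_lt {ι M : Type*} [Fintype ι] [LinearOrder ι] [CommMonoid M]
    (G : ι → ι → M) :
    ∏ p ∈ (univ : Finset ι).offDiag, G p.1 p.2 =
      ∏ p ∈ (univ : Finset (ι × ι)).filter (fun p => p.1 < p.2), G p.1 p.2 * G p.2 p.1 := by
  have h : ∏ p ∈ (univ : Finset ι).offDiag, G p.1 p.2 =
      (∏ p : ι × ι, if p.1 < p.2 then G p.1 p.2 else 1) *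
        ∏ p : ι × ι, if p.2 < p.1 then G p.1 p.2 else 1 := by
    have : (univ : Finset ι).offDiag = univ.filter fun p => p.1 ≠ p.2 := by ext; simp
    rw [this, prod_filter, ← prod_mul_distrib]
    refine prod_congr rfl fun p _ => ?_
    rcases lt_trichotomy p.1 p.2 with h | h | h
    · simp [h, h.ne, h.not_gt]
    · simp [h]
    · simp [h, h.ne', h.not_gt]
  have h' : (∏ p : ι × ι, if p.2 < p.1 then G p.1 p.2 else 1) =
      ∏ p : ι × ι, if p.1 < p.2 then G p.2 p.1 else 1 :=
    Fintype.prod_equiv (Equiv.prodComm ι ι) _ _ fun p => rfl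
  rw [h, h', ← prod_mul_distrib, prod_filter]
  refine prod_congr rfl fun p _ => ?_
  split_ifs <;> simp

theorem cross_mul_eq_scatterTerm {q s : ℂ} {r : ℝ} (hq : ‖q‖ < 1) (hs : ‖s‖ < r)
    (hs' : ‖s‖ * r < 1) {k : ℕ} (lam mu : Fin k → ℕ) (ρ : Equiv.Perm (Fin k))
    {v : Fin k → ℂ} (hv : v ∈ torus k r) (hinj : Function.Injective v) :
    (∏ p ∈ (univ : Finset (Fin k)).offDiag, (v p.1 - v p.2) / (v p.1 - q * v p.2)) *
      ((∏ i, (1 - s * v i))⁻¹ *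
        ((∏ p ∈ (univ : Finset (Fin k × Fin k)).filter (fun p => p.1 < p.2),
          (v p.1 - q * v p.2) / (v p.1 - v p.2)) *
        ∏ i, ((v i - s) / (1 - s * v i)) ^ lam i)) *
      ((∏ i, (1 - s * (v i)⁻¹))⁻¹ *
        ((∏ p ∈ (univ : Finset (Fin k × Fin k)).filter (fun p => p.1 < p.2),
          ((v (ρ p.1))⁻¹ - q * (v (ρ p.2))⁻¹) / ((v (ρ p.1))⁻¹ - (v (ρ p.2))⁻¹)) *
        ∏ i, (((v (ρ i))⁻¹ - s) / (1 - s * (v (ρ i))⁻¹)) ^ mu i)) =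
      scatterTerm q s lam mu ρ v := by
  have hr : 0 < r := (norm_nonneg s).trans_lt hs
  have hn := mem_torus_iff.1 hv
  have h0 : ∀ i, v i ≠ 0 := fun i h => by
    have := hn i
    rw [h, norm_zero] at this
    exact hr.ne this
  have h1 : ∀ i, 1 - s * v i ≠ 0 := fun i => one_sub_mul_ne_zero_of_norm hs' (hn i).le
  have h2 : ∀ i, v i - s ≠ 0 := fun i => sub_ne_zero_of_norm hs (hn i)
  have h3 : ∀ i j, v j - q * v i ≠ 0 := fun i j =>
    sub_mul_ne_zero_of_norm hq hr (hn i).le (hn j)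
  have h4 : ∏ i, (((v (ρ i))⁻¹ - s) / (1 - s * (v (ρ i))⁻¹)) ^ mu i =
      ∏ i, ((1 - s * v i) / (v i - s)) ^ mu (ρ.symm i) := by
    refine Fintype.prod_equiv ρ _ _ fun i => ?_
    rw [ρ.symm_apply_apply]
    congr 1
    have := h0 (ρ i)
    have h2' : 1 - s * (v (ρ i))⁻¹ ≠ 0 := by
      have := h2 (ρ i)
      field_simp
      exact div_ne_zero this (h0 _)
    have := h2 (ρ i)
    field_simp
  have h5 : (∏ i, (1 - s * (v i)⁻¹))⁻¹ = ∏ i, v i / (v i - s) := by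
    rw [← prod_inv_distrib]
    refine prod_congr rfl fun i _ => ?_
    have := h0 i
    rw [← inv_div]
    congr 1
    field_simp
  rw [prod_lt_comp_perm ρ fun a b => ((v a)⁻¹ - q * (v b)⁻¹) / ((v a)⁻¹ - (v b)⁻¹),
    prod_offDiag_eq_prod_lt fun a b => (v a - v b) / (v a - q * v b), h4, h5, scatterTerm]
  have h6 : ∏ p ∈ (univ : Finset (Fin k × Fin k)).filter (fun p => p.1 < p.2),
      (if ρ.symm p.1 < ρ.symm p.2 then (1 : ℂ)
        else -((v p.1 - q * v p.2) / (v p.2 - q * v p.1))) =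
      (∏ p ∈ (univ : Finset (Fin k × Fin k)).filter (fun p => p.1 < p.2),
        (v p.1 - v p.2) / (v p.1 - q * v p.2) * ((v p.2 - v p.1) / (v p.2 - q * v p.1))) *
      (∏ p ∈ (univ : Finset (Fin k × Fin k)).filter (fun p => p.1 < p.2),
        (v p.1 - q * v p.2) / (v p.1 - v p.2)) *
      ∏ p ∈ (univ : Finset (Fin k × Fin k)).filter (fun p => p.1 < p.2),
        if ρ.symm p.1 < ρ.symm p.2 then
          ((v p.1)⁻¹ - q * (v p.2)⁻¹) / ((v p.1)⁻¹ - (v p.2)⁻¹)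
        else ((v p.2)⁻¹ - q * (v p.1)⁻¹) / ((v p.2)⁻¹ - (v p.1)⁻¹) := by
    rw [← prod_mul_distrib, ← prod_mul_distrib]
    refine prod_congr rfl fun p hp => ?_
    have hne : v p.1 ≠ v p.2 := hinj.ne (mem_filter.1 hp).2.ne
    have hg : ∀ a b : ℂ, a ≠ 0 → b ≠ 0 → (a⁻¹ - q * b⁻¹) / (a⁻¹ - b⁻¹) =
        (b - q * a) / (b - a) := by
      intro a b ha hb
      rw [← mul_div_mul_right _ _ (mul_ne_zero ha hb)]
      congr 1 <;> field_simp
    rw [hg _ _ (h0 _) (h0 _), hg _ _ (h0 _) (h0 _)]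
    have ha := sub_ne_zero.2 hne
    have hb := sub_ne_zero.2 hne.symm
    have hc : v p.2 - v p.1 * q ≠ 0 := by simpa [mul_comm] using h3 p.1 p.2
    have hd : v p.1 - v p.2 * q ≠ 0 := by simpa [mul_comm] using h3 p.2 p.1
    rw [mul_comm q, mul_comm q]
    split_ifs
    · field_simp
    · field_simp
      ring
  rw [h6]
  simp only [prod_mul_distrib (s := (univ : Finset (Fin k)))]
  have h7 : ∏ i, v i / ((1 - s * v i) * (v i - s)) =
      (∏ i, (1 - s * v i))⁻¹ * ∏ i, v i / (v i - s) := by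
    rw [← prod_inv_distrib, ← prod_mul_distrib]
    refine prod_congr rfl fun i _ => ?_
    rw [div_mul_eq_div_div, div_right_comm, inv_mul_eq_div]
  rw [h7]
  generalize (∏ p ∈ (univ : Finset (Fin k × Fin k)).filter (fun p => p.1 < p.2),
    (v p.1 - v p.2) / (v p.1 - q * v p.2) * ((v p.2 - v p.1) / (v p.2 - q * v p.1))) = P₁,
    (∏ i, (1 - s * v i))⁻¹ = P₂
  ring

/-- The integrand of the spatial pairing, relative to the uniform measure on the torus. -/
def spatialIntegrand (q s : ℂ) {k : ℕ} (lam mu : Fin k → ℕ) (u : Fin k → ℂ) : ℂ :=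
  (∏ p ∈ (univ : Finset (Fin k)).offDiag, (u p.1 - u p.2) / (u p.1 - q * u p.2)) *
    Ffun q s lam u * Ffun q s mu (fun i => (u i)⁻¹)

theorem spatialIntegrand_eq_sum {q s : ℂ} {r : ℝ} (hq : ‖q‖ < 1) (hs : ‖s‖ < r)
    (hs' : ‖s‖ * r < 1) {k : ℕ} (lam mu : Fin k → ℕ)
    {u : Fin k → ℂ} (hu : u ∈ torus k r) (hinj : Function.Injective u) :
    spatialIntegrand q s lam mu u =
      ((1 - q) ^ k) ^ 2 * ∑ σ : Equiv.Perm (Fin k), ∑ ρ : Equiv.Perm (Fin k),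
        scatterTerm q s lam mu ρ (u ∘ σ) := by
  have hterm (σ : Equiv.Perm (Fin k)) (ρ : Equiv.Perm (Fin k)) :=
    cross_mul_eq_scatterTerm hq hs hs' lam mu ρ (comp_perm_mem_torus hu σ)
      (hinj.comp σ.injective)
  simp only [← hterm, spatialIntegrand, Ffun]
  rw [mul_assoc, mul_mul_mul_comm, sum_mul_sum, mul_sum, mul_sum, mul_sum]
  refine sum_congr rfl fun σ _ => ?_
  rw [← Equiv.sum_comp (Equiv.mulLeft σ), mul_sum, mul_sum, mul_sum]
  refine sum_congr rfl fun ρ _ => ?_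
  have h1 : ∏ i, (1 - s * (u ∘ σ) i) = ∏ i, (1 - s * u i) :=
    Equiv.prod_comp σ fun i => 1 - s * u i
  have h2 : ∏ i, (1 - s * ((u ∘ σ) i)⁻¹) = ∏ i, (1 - s * (u i)⁻¹) :=
    Equiv.prod_comp σ fun i => 1 - s * (u i)⁻¹
  have h3 : ∏ p ∈ (univ : Finset (Fin k)).offDiag,
      ((u ∘ σ) p.1 - (u ∘ σ) p.2) / ((u ∘ σ) p.1 - q * (u ∘ σ) p.2) =
      ∏ p ∈ (univ : Finset (Fin k)).offDiag, (u p.1 - u p.2) / (u p.1 - q * u p.2) :=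
    prod_equiv (Equiv.prodCongr σ σ) (by simp) fun p _ => rfl
  rw [h1, h2, h3]
  simp only [Equiv.coe_mulLeft, Equiv.Perm.mul_apply, Function.comp_apply]
  ring

theorem iterInt_spatialIntegrand {q s : ℂ} {r : ℝ} (hq : ‖q‖ < 1) (hs : ‖s‖ < r)
    (hs' : ‖s‖ * r < 1) {k : ℕ} (lam mu : Fin k → ℕ) :
    iterInt k (fun _ => fun g => Real.circleAverage g 0 r) (spatialIntegrand q s lam mu) =
      ((1 - q) ^ k) ^ 2 * (k.factorial *
        ∑ ρ : Equiv.Perm (Fin k), ∫ u, scatterTerm q s lam mu ρ u ∂torusMeasure k r) := by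
  have hr : 0 < r := (norm_nonneg s).trans_lt hs
  have hm (ρ σ : Equiv.Perm (Fin k)) :
      Measurable fun u : Fin k → ℂ => scatterTerm q s lam mu ρ (u ∘ σ) :=
    (measurable_scatterTerm q s lam mu ρ).comp (by fun_prop)
  have hc (ρ σ : Equiv.Perm (Fin k)) :
      ContinuousOn (fun u : Fin k → ℂ => scatterTerm q s lam mu ρ (u ∘ σ)) (torus k r) :=
    (continuousOn_scatterTerm hq hs hs' lam mu ρ).comp (by fun_prop)
      fun u hu => comp_perm_mem_torus hu σ
  rw [iterInt_circleAverage_congr hr ∅ Set.finite_empty fun u hu hinj _ =>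
      spatialIntegrand_eq_sum hq hs hs' lam mu hu hinj,
    iterInt_circleAverage_eq_integral hr
      ((Finset.measurable_sum _ fun σ _ => Finset.measurable_sum _ fun ρ _ => hm ρ σ).const_mul _)
      (continuousOn_const.mul <|
        continuousOn_finsetSum _ fun σ _ => continuousOn_finsetSum _ fun ρ _ => hc ρ σ),
    MeasureTheory.integral_const_mul, MeasureTheory.integral_finsetSum _ fun σ _ =>
      MeasureTheory.integrable_finsetSum _ fun ρ _ => integrable_torusMeasure hr (hc ρ σ)]
  congr 1
  have h (σ : Equiv.Perm (Fin k)) :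
      ∫ u, ∑ ρ : Equiv.Perm (Fin k), scatterTerm q s lam mu ρ (u ∘ σ) ∂torusMeasure k r =
      ∑ ρ : Equiv.Perm (Fin k), ∫ u, scatterTerm q s lam mu ρ u ∂torusMeasure k r := by
    rw [MeasureTheory.integral_finsetSum _ fun ρ _ => integrable_torusMeasure hr (hc ρ σ)]
    exact sum_congr rfl fun ρ _ => integral_torusMeasure_perm σ _
  rw [sum_congr rfl fun σ _ => h σ, sum_const, card_univ, Fintype.card_perm, Fintype.card_fin,
    nsmul_eq_mul]

theorem differentiable_insertNth_apply {k : ℕ} (j i : Fin (k + 1)) (y : Fin k → ℂ) :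
    Differentiable ℂ fun z : ℂ => (j.insertNth z y : Fin (k + 1) → ℂ) i := by
  rcases Fin.eq_self_or_eq_succAbove j i with rfl | ⟨i, rfl⟩ <;> simp

theorem circleAverage_eq_zero_of_differentiableOn {r : ℝ} (hr : 0 < r) {f H : ℂ → ℂ}
    (hH : DifferentiableOn ℂ H (Metric.closedBall 0 r)) (hf : ∀ z, ‖z‖ = r → f z = z * H z) :
    Real.circleAverage f 0 r = 0 := by
  have h : Real.circleAverage f 0 r = Real.circleAverage (fun z => z * H z) 0 r := by
    refine Real.circleAverage_congr_sphere fun z hz => hf z ?_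
    simpa [abs_of_pos hr] using hz
  have hd : DiffContOnCl ℂ (fun z => z * H z) (Metric.ball 0 |r|) := by
    refine DifferentiableOn.diffContOnCl ?_
    rw [abs_of_pos hr, closure_ball _ hr.ne']
    exact differentiableOn_id.mul hH
  rw [h, hd.circleAverage, zero_mul]

theorem integral_scatterTerm_eq_zero {q s : ℂ} {r : ℝ} (hq : ‖q‖ < 1) (hs : ‖s‖ < r)
    (hs' : ‖s‖ * r < 1) {k : ℕ} {lam mu : Fin (k + 1) → ℕ} {ρ : Equiv.Perm (Fin (k + 1))}
    {j : Fin (k + 1)} (hj : ∀ i < j, ρ.symm i < ρ.symm j) (hlt : mu (ρ.symm j) < lam j) :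
    ∫ u, scatterTerm q s lam mu ρ u ∂torusMeasure (k + 1) r = 0 := by
  have hr : 0 < r := (norm_nonneg s).trans_lt hs
  rw [integral_torusMeasure_eq_of_circleAverage hr j (g := 0) (measurable_scatterTerm q s lam mu ρ)
    (continuousOn_scatterTerm hq hs hs' lam mu ρ)]
  · simp
  intro y hy
  have hn (z : ℂ) (hz : ‖z‖ ≤ r) (i : Fin (k + 1)) :
      ‖(j.insertNth z y : Fin (k + 1) → ℂ) i‖ ≤ r := by
    rcases Fin.eq_self_or_eq_succAbove j i with rfl | ⟨i, rfl⟩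
    · simpa using hz
    · simpa using (mem_torus_iff.1 hy i).le
  have hn' (z : ℂ) (i : Fin (k + 1)) (hi : i ≠ j) :
      ‖(j.insertNth z y : Fin (k + 1) → ℂ) i‖ = r := by
    rcases Fin.eq_self_or_eq_succAbove j i with rfl | ⟨i, rfl⟩
    · exact absurd rfl hi
    · simpa using mem_torus_iff.1 hy i
  refine circleAverage_eq_zero_of_differentiableOn hr
    (H := fun z => (∏ p ∈ (univ : Finset (Fin (k + 1) × Fin (k + 1))).filter (fun p => p.1 < p.2),
      if ρ.symm p.1 < ρ.symm p.2 then 1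
      else -(((j.insertNth z y : Fin (k + 1) → ℂ) p.1 -
        q * (j.insertNth z y : Fin (k + 1) → ℂ) p.2) /
        ((j.insertNth z y : Fin (k + 1) → ℂ) p.2 -
          q * (j.insertNth z y : Fin (k + 1) → ℂ) p.1))) *
      (((z - s) / (1 - s * z)) ^ (lam j - mu (ρ.symm j) - 1) / (1 - s * z) ^ 2 *
      ∏ i : Fin k, ((y i - s) / (1 - s * y i)) ^ lam (j.succAbove i) *
        ((1 - s * y i) / (y i - s)) ^ mu (ρ.symm (j.succAbove i)) *
        (y i / ((1 - s * y i) * (y i - s))))) ?_ ?_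
  · have h1 : ∀ z ∈ Metric.closedBall (0 : ℂ) r, 1 - s * z ≠ 0 := fun z hz =>
      one_sub_mul_ne_zero_of_norm hs' (by simpa using hz)
    refine DifferentiableOn.mul (DifferentiableOn.fun_finsetProd fun p hp => ?_)
      (DifferentiableOn.mul ?_ (differentiableOn_const _))
    · split_ifs with h
      · exact differentiableOn_const _
      · have hd (i : Fin (k + 1)) := (differentiable_insertNth_apply j i y).differentiableOn
          (s := Metric.closedBall (0 : ℂ) r)
        refine (DifferentiableOn.div ((hd _).sub ((hd _).const_mul _))
          ((hd _).sub ((hd _).const_mul _)) fun z hz => ?_).neg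
        refine sub_mul_ne_zero_of_norm hq hr (hn z (by simpa using hz) _) (hn' z _ ?_)
        intro e
        exact h (e ▸ hj p.1 (e ▸ (mem_filter.1 hp).2))
    · exact ((DifferentiableOn.div (by fun_prop) (by fun_prop) h1).pow _).div (by fun_prop)
        fun z hz => pow_ne_zero 2 (h1 z hz)
  · intro z hz
    have h1 : 1 - s * z ≠ 0 := one_sub_mul_ne_zero_of_norm hs' hz.le
    have h2 : z - s ≠ 0 := sub_ne_zero_of_norm hs hz
    obtain ⟨d, hd⟩ := Nat.exists_eq_add_of_lt hlt
    have hj' : ((z - s) / (1 - s * z)) ^ lam j * ((1 - s * z) / (z - s)) ^ mu (ρ.symm j) *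
        (z / ((1 - s * z) * (z - s))) =
        z * (((z - s) / (1 - s * z)) ^ (lam j - mu (ρ.symm j) - 1) / (1 - s * z) ^ 2) := by
      have e : lam j - mu (ρ.symm j) - 1 = d := by omega
      rw [e, hd, add_assoc, pow_add, pow_succ, ← inv_div (z - s), inv_pow]
      have hφ : ((z - s) / (1 - s * z)) ^ mu (ρ.symm j) ≠ 0 := pow_ne_zero _ (div_ne_zero h2 h1)
      generalize ((z - s) / (1 - s * z)) ^ mu (ρ.symm j) = a at hφ
      generalize ((z - s) / (1 - s * z)) ^ d = b
      field_simp
    rw [scatterTerm, Fin.prod_univ_succAbove _ j]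
    simp only [Fin.insertNth_apply_same, Fin.insertNth_apply_succAbove]
    rw [hj']
    ring

theorem le_of_integral_scatterTerm_ne_zero {q s : ℂ} {r : ℝ} (hq : ‖q‖ < 1) (hs : ‖s‖ < r)
    (hs' : ‖s‖ * r < 1) {k : ℕ} {lam mu : Fin k → ℕ} (hl : Antitone lam) (hm : Antitone mu)
    {ρ : Equiv.Perm (Fin k)} (h : ∫ u, scatterTerm q s lam mu ρ u ∂torusMeasure k r ≠ 0)
    (i : Fin k) : lam i ≤ mu i ∧ lam i ≤ mu (ρ.symm i) := by
  cases k with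
  | zero => exact i.elim0
  | succ k =>
    refine exists_ge_of_forall_le_max hl hm ρ.symm (fun j hj => ?_) i
    by_contra! hlt
    exact h (integral_scatterTerm_eq_zero hq hs hs' hj hlt)

theorem iterInt_spatialIntegrand_eq_zero_of_lt {q s : ℂ} {r : ℝ} (hq : ‖q‖ < 1) (hs : ‖s‖ < r)
    (hs' : ‖s‖ * r < 1) {k : ℕ} {lam mu : Fin k → ℕ} (hl : Antitone lam) (hm : Antitone mu)
    {i : Fin k} (hi : mu i < lam i) :
    iterInt k (fun _ => fun g => Real.circleAverage g 0 r) (spatialIntegrand q s lam mu) = 0 := by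
  rw [iterInt_spatialIntegrand hq hs hs', sum_eq_zero, mul_zero, mul_zero]
  intro ρ _
  by_contra h
  exact hi.not_ge (le_of_integral_scatterTerm_ne_zero hq hs hs' hl hm h i).1

theorem spatialIntegrand_inv {q s : ℂ} {k : ℕ} (lam mu : Fin k → ℕ) {u : Fin k → ℂ}
    (hu : ∀ i, u i ≠ 0) :
    spatialIntegrand q s lam mu (fun i => (u i)⁻¹) = spatialIntegrand q s mu lam u := by
  have h : ∏ p ∈ (univ : Finset (Fin k)).offDiag,
      ((u p.1)⁻¹ - (u p.2)⁻¹) / ((u p.1)⁻¹ - q * (u p.2)⁻¹) =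
      ∏ p ∈ (univ : Finset (Fin k)).offDiag, (u p.1 - u p.2) / (u p.1 - q * u p.2) := by
    refine prod_equiv (Equiv.prodComm _ _) (by simp [eq_comm]) fun p _ => ?_
    simp only [Equiv.prodComm_apply, Prod.fst_swap, Prod.snd_swap]
    have h1 := hu p.1
    have h2 := hu p.2
    rw [← mul_div_mul_right _ _ (mul_ne_zero h1 h2)]
    congr 1 <;> field_simp
  simp only [spatialIntegrand, inv_inv]
  rw [h]
  ring

theorem iterInt_spatialIntegrand_eq_zero {q s : ℂ} {r : ℝ} (hq : ‖q‖ < 1) (hs : ‖s‖ < r)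
    (hs' : ‖s‖ * r < 1) {k : ℕ} {lam mu : Fin k → ℕ} (hl : Antitone lam) (hm : Antitone mu)
    (hne : lam ≠ mu) :
    iterInt k (fun _ => fun g => Real.circleAverage g 0 r) (spatialIntegrand q s lam mu) = 0 := by
  have hr : 0 < r := (norm_nonneg s).trans_lt hs
  obtain ⟨i, hi⟩ := Function.ne_iff.1 hne
  rcases hi.lt_or_gt with hi | hi
  · have hinv : iterInt k (fun _ => fun g => Real.circleAverage g 0 r)
          (spatialIntegrand q s lam mu) =
        iterInt k (fun _ => fun g => Real.circleAverage g 0 r)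
          (fun u => spatialIntegrand q s mu lam fun i => (u i)⁻¹) := by
      refine iterInt_circleAverage_congr hr ∅ Set.finite_empty fun u hu _ _ => ?_
      refine (spatialIntegrand_inv mu lam fun i h => ?_).symm
      have := mem_torus_iff.1 hu i
      rw [h, norm_zero] at this
      exact hr.ne this
    rw [hinv, iterInt_circleAverage_inv]
    refine iterInt_spatialIntegrand_eq_zero_of_lt hq ?_ ?_ hm hl hi
    · rwa [← one_div, lt_div_iff₀ hr]
    · rwa [← div_eq_mul_inv, div_lt_one hr]
  · exact iterInt_spatialIntegrand_eq_zero_of_lt hq hs hs' hl hm hi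

/-- The kernel left in the diagonal pairing of `lam` with itself after summation over the
stabilizer of `lam`, with the poles at `s` moved to the points `a i`. -/
def blockKernel (q s : ℂ) {k : ℕ} (lam : Fin k → ℕ) (a u : Fin k → ℂ) : ℂ :=
  (∏ p ∈ (univ : Finset (Fin k × Fin k)).filter (fun p => p.1 < p.2),
    if lam p.1 = lam p.2 then (u p.2 - u p.1) / (u p.2 - q * u p.1) else 1) *
  ∏ i, u i / ((1 - s * u i) * (u i - a i))

theorem measurable_blockKernel (q s : ℂ) {k : ℕ} (lam : Fin k → ℕ) (a : Fin k → ℂ) :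
    Measurable (blockKernel q s lam a) := by
  refine Measurable.mul (Finset.measurable_prod _ fun p _ => ?_)
    (Finset.measurable_prod _ fun i _ => by fun_prop)
  split_ifs <;> fun_prop

theorem continuousOn_blockKernel {q s : ℂ} {r : ℝ} (hq : ‖q‖ < 1) (hr : 0 < r)
    (hs : ‖s‖ * r < 1) {k : ℕ} (lam : Fin k → ℕ) {a : Fin k → ℂ} (ha : ∀ i, ‖a i‖ < r) :
    ContinuousOn (blockKernel q s lam a) (torus k r) := by
  refine ContinuousOn.mul (continuousOn_finsetProd _ fun p _ => ?_)
    (continuousOn_finsetProd _ fun i _ => ?_)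
  · split_ifs
    · exact ContinuousOn.div (by fun_prop) (by fun_prop) fun u hu =>
        sub_mul_ne_zero_of_norm hq hr (mem_torus_iff.1 hu _).le (mem_torus_iff.1 hu _)
    · exact continuousOn_const
  · exact ContinuousOn.div (by fun_prop) (by fun_prop) fun u hu =>
      mul_ne_zero (one_sub_mul_ne_zero_of_norm hs (mem_torus_iff.1 hu i).le)
        (sub_ne_zero_of_norm (ha i) (mem_torus_iff.1 hu i))

theorem blockKernel_cons (q s : ℂ) {k : ℕ} (lam : Fin (k + 1) → ℕ) (a : Fin (k + 1) → ℂ)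
    (z : ℂ) (y : Fin k → ℂ) :
    blockKernel q s lam a (Fin.cons z y) =
      (z - 0) / (z - a 0) * ((1 - s * z)⁻¹ *
        (∏ j : Fin k, if lam 0 = lam j.succ then (y j - z) / (y j - q * z) else 1) *
        blockKernel q s (fun j => lam j.succ) (fun j => a j.succ) y) := by
  rw [blockKernel, prod_pairs_succ fun i j => if lam i = lam j then
      ((Fin.cons z y : Fin (k + 1) → ℂ) j - (Fin.cons z y : Fin (k + 1) → ℂ) i) /
      ((Fin.cons z y : Fin (k + 1) → ℂ) j - q * (Fin.cons z y : Fin (k + 1) → ℂ) i) else 1,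
    Fin.prod_univ_succ, blockKernel]
  simp only [Fin.cons_zero, Fin.cons_succ, sub_zero]
  rw [div_mul_eq_div_div, div_right_comm, div_eq_mul_inv (z / (z - a 0))]
  ring

theorem circleAverage_blockKernel_cons {q s : ℂ} {r : ℝ} (hq : ‖q‖ < 1) (hr : 0 < r)
    (hs : ‖s‖ * r < 1) {k : ℕ} {lam : Fin (k + 1) → ℕ} {a : Fin (k + 1) → ℂ}
    (ha : ∀ i, ‖a i‖ < r) (hblock : ∀ i j, lam i = lam j → a i = a j)
    {y : Fin k → ℂ} (hy : y ∈ torus k r) :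
    Real.circleAverage (fun z => blockKernel q s lam a (Fin.cons z y)) 0 r =
      (1 - s * a 0)⁻¹ * blockKernel q s (fun j => lam j.succ)
        (fun j => if lam 0 = lam j.succ then q * a 0 else a j.succ) y := by
  simp only [blockKernel_cons]
  have hd : DiffContOnCl ℂ (fun z => (1 - s * z)⁻¹ *
      (∏ j : Fin k, if lam 0 = lam j.succ then (y j - z) / (y j - q * z) else 1) *
      blockKernel q s (fun j => lam j.succ) (fun j => a j.succ) y) (Metric.ball 0 |r|) := by
    refine DifferentiableOn.diffContOnCl ?_
    rw [abs_of_pos hr, closure_ball _ hr.ne']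
    refine DifferentiableOn.mul (DifferentiableOn.mul (DifferentiableOn.inv (by fun_prop) fun z hz =>
      one_sub_mul_ne_zero_of_norm hs (by simpa using hz))
      (DifferentiableOn.fun_finsetProd fun j _ => ?_)) (differentiableOn_const _)
    split_ifs
    · exact DifferentiableOn.div (by fun_prop) (by fun_prop) fun z hz =>
        sub_mul_ne_zero_of_norm hq hr (by simpa using hz) (mem_torus_iff.1 hy j)
    · exact differentiableOn_const _
  have h := hd.circleAverage_smul_div (w := a 0) (by simpa [abs_of_pos hr] using ha 0)
  simp only [smul_eq_mul] at h
  rw [h, mul_assoc]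
  congr 1
  rw [blockKernel, blockKernel, mul_left_comm, ← prod_mul_distrib]
  congr 1
  refine prod_congr rfl fun j _ => ?_
  split_ifs with hj
  · have h1 : y j - a 0 ≠ 0 := sub_ne_zero_of_norm (ha 0) (mem_torus_iff.1 hy j)
    rw [← hblock _ _ hj, div_mul_div_comm, mul_comm (y j - a 0), ← mul_assoc (y j - q * a 0),
      mul_div_mul_right _ _ h1, mul_comm (y j - q * a 0)]
  · rw [one_mul]

theorem integral_blockKernel {q s : ℂ} {r : ℝ} (hq : ‖q‖ < 1) (hr : 0 < r)
    (hs : ‖s‖ * r < 1) {k : ℕ} (lam : Fin k → ℕ) (a : Fin k → ℂ)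
    (ha : ∀ i, ‖a i‖ < r) (hblock : ∀ i j, lam i = lam j → a i = a j) :
    ∫ u, blockKernel q s lam a u ∂torusMeasure k r =
      ∏ i, (1 - s * (a i * q ^ #{j | j < i ∧ lam j = lam i}))⁻¹ := by
  induction k with
  | zero =>
    rw [torusMeasure, MeasureTheory.Measure.pi_of_empty _ Fin.elim0,
      MeasureTheory.integral_dirac]
    simp [blockKernel]
  | succ k ih =>
    rw [integral_torusMeasure_eq_of_circleAverage hr 0 (measurable_blockKernel q s lam a)
      (continuousOn_blockKernel hq hr hs lam ha) fun y hy => by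
        simpa only [Fin.insertNth_zero'] using
          circleAverage_blockKernel_cons hq hr hs ha hblock hy,
      MeasureTheory.integral_const_mul, ih, Fin.prod_univ_succ]
    · congr 1
      · simp
      · refine prod_congr rfl fun i _ => ?_
        rw [Fin.card_filter_univ_succ]
        simp only [Fin.succ_pos, true_and, Fin.succ_lt_succ_iff]
        split_ifs with hi
        · rw [← hblock _ _ hi, pow_succ]
          ring
        · rfl
    · intro i
      split_ifs
      · rw [norm_mul]
        nlinarith [norm_nonneg (a 0), ha 0, norm_nonneg q]
      · exact ha _
    · intro i j hij
      simp only [hij, hblock _ _ hij]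

theorem scatterTerm_eq_of_comp_eq {q s : ℂ} {r : ℝ} (hq : ‖q‖ < 1) (hs : ‖s‖ < r)
    (hs' : ‖s‖ * r < 1) {k : ℕ} {lam : Fin k → ℕ} (hl : Antitone lam)
    {ρ : Equiv.Perm (Fin k)} (hρ : lam ∘ ρ = lam) {u : Fin k → ℂ} (hu : u ∈ torus k r)
    (hinj : Function.Injective u) :
    scatterTerm q s lam lam ρ u =
      (∏ p ∈ (univ : Finset (Fin k × Fin k)).filter (fun p => p.1 < p.2),
        if lam p.1 = lam p.2 then
          (u (ρ p.2) - q * u (ρ p.1)) / (u (ρ p.2) - u (ρ p.1)) else 1) *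
      blockKernel q s lam (fun _ => s) u := by
  have hr : 0 < r := (norm_nonneg s).trans_lt hs
  have hn := mem_torus_iff.1 hu
  have hρ' (i : Fin k) : lam (ρ i) = lam i := congrFun hρ i
  have hsymm (i : Fin k) : lam (ρ.symm i) = lam i := by rw [← hρ', ρ.apply_symm_apply]
  have h1 : ∏ i, ((u i - s) / (1 - s * u i)) ^ lam i *
      ((1 - s * u i) / (u i - s)) ^ lam (ρ.symm i) * (u i / ((1 - s * u i) * (u i - s))) =
      ∏ i, u i / ((1 - s * u i) * (u i - s)) := by
    refine prod_congr rfl fun i _ => ?_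
    rw [hsymm, ← mul_pow, div_mul_div_comm, mul_comm (u i - s), div_self, one_pow, one_mul]
    exact mul_ne_zero (one_sub_mul_ne_zero_of_norm hs' (hn i).le) (sub_ne_zero_of_norm hs (hn i))
  have h2 : ∏ p ∈ (univ : Finset (Fin k × Fin k)).filter (fun p => p.1 < p.2),
      (if ρ.symm p.1 < ρ.symm p.2 then (1 : ℂ)
        else -((u p.1 - q * u p.2) / (u p.2 - q * u p.1))) =
      (∏ p ∈ (univ : Finset (Fin k × Fin k)).filter (fun p => p.1 < p.2),
        (u p.2 - u p.1) / (u p.2 - q * u p.1)) *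
      ∏ p ∈ (univ : Finset (Fin k × Fin k)).filter (fun p => p.1 < p.2),
        (u (ρ p.2) - q * u (ρ p.1)) / (u (ρ p.2) - u (ρ p.1)) := by
    rw [prod_lt_comp_perm ρ fun a b => (u b - q * u a) / (u b - u a), ← prod_mul_distrib]
    refine prod_congr rfl fun p hp => ?_
    have ha : u p.2 - u p.1 ≠ 0 := sub_ne_zero.2 (hinj.ne (mem_filter.1 hp).2.ne')
    have hb : u p.2 - q * u p.1 ≠ 0 := sub_mul_ne_zero_of_norm hq hr (hn _).le (hn _)
    split_ifs
    · rw [div_mul_div_cancel₀ hb, div_self ha]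
    · rw [← neg_sub (u p.2) (u p.1), div_neg, mul_neg,
        mul_comm ((u p.2 - u p.1) / _), div_mul_div_cancel₀ ha]
  have h3 (w : Fin k → ℂ) :
      ∏ p ∈ (univ : Finset (Fin k × Fin k)).filter (fun p => p.1 < p.2),
        (w p.2 - q * w p.1) / (w p.2 - w p.1) =
      (∏ p ∈ (univ : Finset (Fin k × Fin k)).filter (fun p => p.1 < p.2),
        if lam p.1 = lam p.2 then (w p.2 - q * w p.1) / (w p.2 - w p.1) else 1) *
      ∏ p : Fin k × Fin k,
        if lam p.2 < lam p.1 then (w p.2 - q * w p.1) / (w p.2 - w p.1) else 1 := by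
    rw [prod_filter, prod_filter, ← prod_mul_distrib]
    refine prod_congr rfl fun p _ => ?_
    rcases lt_or_ge p.1 p.2 with h | h
    · rcases (hl h.le).lt_or_eq with h' | h'
      · simp [h, h', h'.ne']
      · simp [h, h']
    · simp [h.not_gt, (hl h).not_gt]
  have h4 : (∏ p : Fin k × Fin k, if lam p.2 < lam p.1 then
      (u (ρ p.2) - q * u (ρ p.1)) / (u (ρ p.2) - u (ρ p.1)) else 1) =
      ∏ p : Fin k × Fin k, if lam p.2 < lam p.1 then
        (u p.2 - q * u p.1) / (u p.2 - u p.1) else 1 :=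
    Fintype.prod_equiv (Equiv.prodCongr ρ ρ) _ _ fun p => by simp [hρ']
  have h5 : (∏ p ∈ (univ : Finset (Fin k × Fin k)).filter (fun p => p.1 < p.2),
        (u p.2 - u p.1) / (u p.2 - q * u p.1)) *
      (∏ p : Fin k × Fin k, if lam p.2 < lam p.1 then
        (u p.2 - q * u p.1) / (u p.2 - u p.1) else 1) =
      ∏ p ∈ (univ : Finset (Fin k × Fin k)).filter (fun p => p.1 < p.2),
        if lam p.1 = lam p.2 then (u p.2 - u p.1) / (u p.2 - q * u p.1) else 1 := by
    rw [prod_filter, prod_filter, ← prod_mul_distrib]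
    refine prod_congr rfl fun p _ => ?_
    rcases lt_or_ge p.1 p.2 with h | h
    · rcases (hl h.le).lt_or_eq with h' | h'
      · have ha : u p.2 - u p.1 ≠ 0 := sub_ne_zero.2 (hinj.ne h.ne')
        have hb : u p.2 - q * u p.1 ≠ 0 := sub_mul_ne_zero_of_norm hq hr (hn _).le (hn _)
        simp only [h, h', h'.ne', if_true, if_false]
        rw [div_mul_div_cancel₀ hb, div_self ha]
      · simp [h, h']
    · simp [h.not_gt, (hl h).not_gt]
  rw [scatterTerm, h1, h2, h3 fun i => u (ρ i), h4, blockKernel, ← h5]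
  ring

theorem sum_integral_scatterTerm {q s : ℂ} {r : ℝ} (hq : ‖q‖ < 1) (hs : ‖s‖ < r)
    (hs' : ‖s‖ * r < 1) {k : ℕ} {lam : Fin k → ℕ} (hl : Antitone lam) :
    ∑ ρ : Equiv.Perm (Fin k), ∫ u, scatterTerm q s lam lam ρ u ∂torusMeasure k r =
      (∏ i, ∑ t ∈ range (#{j | i < j ∧ lam j = lam i} + 1), q ^ t) *
        ∏ i, (1 - s * (s * q ^ #{j | j < i ∧ lam j = lam i}))⁻¹ := by
  have hr : 0 < r := (norm_nonneg s).trans_lt hs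
  have hq1 : q ≠ 1 := fun h => by simp [h] at hq
  have hzero (ρ : Equiv.Perm (Fin k)) :
      ∫ u, scatterTerm q s lam lam ρ u ∂torusMeasure k r =
        ∫ u, (if lam ∘ ρ = lam then scatterTerm q s lam lam ρ u else 0) ∂torusMeasure k r := by
    split_ifs with h
    · rfl
    · rw [MeasureTheory.integral_zero]
      by_contra hne
      refine h ?_
      have hsymm := comp_perm_eq_of_le ρ.symm fun i =>
        (le_of_integral_scatterTerm_ne_zero hq hs hs' hl hl hne i).2
      ext i
      have := congrFun hsymm (ρ i)
      simpa using this.symm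
  have hm (ρ : Equiv.Perm (Fin k)) :
      Measurable fun u => if lam ∘ ρ = lam then scatterTerm q s lam lam ρ u else 0 := by
    split_ifs
    · exact measurable_scatterTerm q s lam lam ρ
    · exact measurable_const
  have hc (ρ : Equiv.Perm (Fin k)) : ContinuousOn
      (fun u => if lam ∘ ρ = lam then scatterTerm q s lam lam ρ u else 0) (torus k r) := by
    split_ifs
    · exact continuousOn_scatterTerm hq hs hs' lam lam ρ
    · exact continuousOn_const
  rw [sum_congr rfl fun ρ _ => hzero ρ,
    ← MeasureTheory.integral_finsetSum _ fun ρ _ => integrable_torusMeasure hr (hc ρ),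
    ← iterInt_circleAverage_eq_integral hr (Finset.measurable_sum _ fun ρ _ => hm ρ)
      (continuousOn_finsetSum _ fun ρ _ => hc ρ),
    ← integral_blockKernel hq hr hs' lam (fun _ => s) (fun _ => hs) (fun _ _ _ => rfl),
    ← MeasureTheory.integral_const_mul,
    ← iterInt_circleAverage_eq_integral hr
      ((measurable_blockKernel q s lam _).const_mul _)
      (continuousOn_const.mul (continuousOn_blockKernel hq hr hs' lam fun _ => hs))]
  refine iterInt_circleAverage_congr hr ∅ Set.finite_empty fun u hu hinj _ => ?_
  have h0 (i : Fin k) : u i ≠ 0 := fun h => by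
    have := mem_torus_iff.1 hu i
    rw [h, norm_zero] at this
    exact hr.ne this
  rw [← sum_stabilizer_prod_sub_mul_div_sub lam u hq1 hinj h0, sum_mul]
  refine sum_congr rfl fun ρ _ => ?_
  split_ifs with h
  · exact scatterTerm_eq_of_comp_eq hq hs hs' hl h hu hinj
  · rw [zero_mul]

theorem cconst_eq_prod (q s : ℂ) {k : ℕ} (lam : Fin k → ℕ) :
    cconst q s lam = ∏ i,
      (1 - s ^ 2 * q ^ #{j | j < i ∧ lam j = lam i}) /
        (1 - q * q ^ #{j | j < i ∧ lam j = lam i}) := by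
  rw [prod_card_eq_finprod_mult lam (fun i j => j < i)
    (fun t => (1 - s ^ 2 * q ^ t) / (1 - q * q ^ t))
    fun S => prod_card_filter_lt S fun t => (1 - s ^ 2 * q ^ t) / (1 - q * q ^ t)]
  simp only [cconst, qPoch, prod_div_distrib]

theorem cconst_mul_sum_integral_scatterTerm {q s : ℂ} {r : ℝ} (hq : ‖q‖ < 1) (hs : ‖s‖ < r)
    (hs' : ‖s‖ * r < 1) {k : ℕ} {lam : Fin k → ℕ} (hl : Antitone lam) :
    cconst q s lam * ((1 - q) ^ k *
      ∑ ρ : Equiv.Perm (Fin k), ∫ u, scatterTerm q s lam lam ρ u ∂torusMeasure k r) = 1 := by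
  have hpow (t : ℕ) : ‖q ^ t‖ ≤ 1 := by
    rw [norm_pow]
    exact pow_le_one₀ (norm_nonneg q) hq.le
  rw [sum_integral_scatterTerm hq hs hs' hl, cconst_eq_prod,
    prod_card_eq_finprod_mult lam (fun i j => i < j) (fun t => ∑ t ∈ range (t + 1), q ^ t)
      fun S => prod_card_filter_gt S fun t => ∑ t ∈ range (t + 1), q ^ t,
    ← prod_card_eq_finprod_mult lam (fun i j => j < i) (fun t => ∑ t ∈ range (t + 1), q ^ t)
      fun S => prod_card_filter_lt S fun t => ∑ t ∈ range (t + 1), q ^ t]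
  have hconst : (1 - q) ^ k = ∏ _i : Fin k, (1 - q) := by simp
  rw [hconst, ← prod_mul_distrib, ← prod_mul_distrib, ← prod_mul_distrib]
  refine prod_eq_one fun i _ => ?_
  generalize #{j | j < i ∧ lam j = lam i} = n
  have h1 : 1 - q * q ^ n ≠ 0 :=
    one_sub_mul_ne_zero_of_norm (r := 1) (by simpa using hq) (hpow n)
  have hss : ‖s ^ 2‖ < 1 := by
    rw [norm_pow]
    nlinarith [norm_nonneg s]
  have h2 : 1 - s ^ 2 * q ^ n ≠ 0 :=
    one_sub_mul_ne_zero_of_norm (r := 1) (by simpa using hss) (hpow n)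
  rw [← mul_assoc (1 - q), mul_neg_geom_sum, pow_succ' q n, ← mul_assoc, div_mul_cancel₀ _ h1,
    ← mul_assoc s, ← sq, mul_inv_cancel₀ h2]

/-- Corollary 7.5 (spatial biorthogonality) with the contour `γ[s;0]` realized as the circle of
radius `r ∈ (|s|, |s|⁻¹)` centered at the origin (the same circle for all `k` variables). -/
theorem spatial_biorthogonality (q s : ℝ) (hq : q ∈ Set.Ioo (0 : ℝ) 1)
    (hs : s ∈ Set.Ioo (-1 : ℝ) 0) (k : ℕ) (hk : 1 ≤ k)
    (r : ℝ) (hr1 : |s| < r) (hr2 : r < |s|⁻¹) (lam mu : Sign k) :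
    cconst (q : ℂ) (s : ℂ) lam.1 / ((1 - (q : ℂ)) ^ k * (Nat.factorial k : ℂ)) *
      (1 / (2 * (Real.pi : ℂ) * Complex.I)) ^ k *
      iterInt k (fun _ => fun g => ∮ z in C(0, r), g z)
        (fun u =>
          (∏ p ∈ (Finset.univ : Finset (Fin k)).offDiag,
            (u p.1 - u p.2) / (u p.1 - (q : ℂ) * u p.2)) *
          Ffun (q : ℂ) (s : ℂ) lam.1 u *
          Ffun (q : ℂ) (s : ℂ) mu.1 (fun i => (u i)⁻¹) *
          ∏ i, (u i)⁻¹)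
      = if lam = mu then 1 else 0 := by
  have hr : 0 < r := (abs_nonneg s).trans_lt hr1
  have hq' : ‖(q : ℂ)‖ < 1 := by
    rw [Complex.norm_real, Real.norm_eq_abs, abs_of_pos hq.1]
    exact hq.2
  have hs1 : ‖(s : ℂ)‖ < r := by rwa [Complex.norm_real]
  have hs2 : ‖(s : ℂ)‖ * r < 1 := by
    rw [Complex.norm_real, Real.norm_eq_abs, mul_comm]
    rwa [← one_div, lt_div_iff₀ (abs_pos.2 hs.2.ne)] at hr2
  have hl : Antitone lam.1 := fun i j h => lam.2 i j h
  have hm : Antitone mu.1 := fun i j h => mu.2 i j h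
  have h := iterInt_circleIntegral k hr.ne' (spatialIntegrand (q : ℂ) (s : ℂ) lam.1 mu.1)
  unfold spatialIntegrand at h
  rw [mul_assoc, h]
  change _ * iterInt k _ (spatialIntegrand (q : ℂ) (s : ℂ) lam.1 mu.1) = _
  split_ifs with he
  · subst he
    have hq1 : (1 : ℂ) - q ≠ 0 := by
      rw [sub_ne_zero]
      exact_mod_cast hq.2.ne'
    have hk : (k.factorial : ℂ) ≠ 0 := Nat.cast_ne_zero.2 k.factorial_ne_zero
    rw [iterInt_spatialIntegrand hq' hs1 hs2]
    refine Eq.trans ?_ (cconst_mul_sum_integral_scatterTerm hq' hs1 hs2 hl)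
    field_simp
  · rw [iterInt_spatialIntegrand_eq_zero hq' hs1 hs2 hl hm fun e => he (Subtype.ext e), mul_zero]

end
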